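/- Let f be a holomorphic modular function for SL(2,ℤ), let w be a real quadratic irrational with Galois conjugate w', and let γ ∈ SL(2,ℤ) satisfy γ • w = w and γ • w' = w'. Then the value of the contour integral ∫_{z_0}^{γ z_0} f η_w is independent of the basepoint: for all z_0, z_1 ∈ ℍ, the integral of f(z)·(1/(z−w') − 1/(z−w)) along the segment from z_0 to γ•z_0 equals its integral along the segment from z_1 to γ•z_1. -/

import Mathlib

open Matrix Filter Topology

noncomputable section

/-- The matrix `[[k,1],[1,0]]` of a single partial quotient. -/
def cfMat (k : ℕ+) : Matrix (Fin 2) (Fin 2) ℤ := !![(k : ℤ), 1; 1, 0]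

/-- `γ_W` for a word `W = (k_1, …, k_r)` of positive integers. -/
def gammaWord (W : List ℕ+) : Matrix (Fin 2) (Fin 2) ℤ := (W.map cfMat).prod

/-- `W^n`, the `n`-fold concatenation of the word `W`. -/
def wordPow (W : List ℕ+) (n : ℕ) : List ℕ+ := (List.replicate n W).flatten

/-- `N(W)`: the largest `n` such that `W = V^n` for some word `V`. -/
def wordN (W : List ℕ+) : ℕ := sSup {n : ℕ | ∃ V : List ℕ+, W = wordPow V n}

/-- Möbius action of an integer matrix on `ℝ`. -/
def actR (M : Matrix (Fin 2) (Fin 2) ℤ) (x : ℝ) : ℝ :=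
  ((M 0 0 : ℝ) * x + (M 0 1 : ℝ)) / ((M 1 0 : ℝ) * x + (M 1 1 : ℝ))

/-- Möbius action of an integer matrix on `ℂ`. -/
def actC (M : Matrix (Fin 2) (Fin 2) ℤ) (z : ℂ) : ℂ :=
  ((M 0 0 : ℤ) * z + (M 0 1 : ℤ)) / ((M 1 0 : ℤ) * z + (M 1 1 : ℤ))

/-- Möbius action of a real matrix on `ℝ`. -/
def actRR (M : Matrix (Fin 2) (Fin 2) ℝ) (x : ℝ) : ℝ :=
  (M 0 0 * x + M 0 1) / (M 1 0 * x + M 1 1)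

/-- Möbius action of a real matrix on `ℂ`. -/
def actCR (M : Matrix (Fin 2) (Fin 2) ℝ) (z : ℂ) : ℂ :=
  ((M 0 0 : ℂ) * z + (M 0 1 : ℂ)) / ((M 1 0 : ℂ) * z + (M 1 1 : ℂ))

/-- Automorphy factor `j(M, x) = c·x + d`. -/
def jFac (M : Matrix (Fin 2) (Fin 2) ℝ) (x : ℝ) : ℝ := M 1 0 * x + M 1 1

/-- `w = [\overline{W}]`: `w` is the (unique) real number `> 1` fixed by the Möbius action
of `γ_W`. -/
def IsCFValue (W : List ℕ+) (w : ℝ) : Prop := 1 < w ∧ actR (gammaWord W) w = w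

/-- `w'` is the Galois conjugate of `[\overline{W}]`, i.e. the other real fixed point
of `γ_W`. -/
def IsCFConj (W : List ℕ+) (w w' : ℝ) : Prop := w' ≠ w ∧ actR (gammaWord W) w' = w'

/-- `g = γ_w` is the fundamental automorph of `w`: it fixes `w`, has `ε_w = j(g,w) > 1`, and
the stabilizer of `w` in `SL(2,ℤ)` is exactly `{± g^n : n ∈ ℤ}`. -/
def IsFundAutomorph (w : ℝ) (g : Matrix.SpecialLinearGroup (Fin 2) ℤ) : Prop :=
  actR (g : Matrix (Fin 2) (Fin 2) ℤ) w = w ∧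
  1 < (g 1 0 : ℝ) * w + (g 1 1 : ℝ) ∧
  ∀ M : Matrix.SpecialLinearGroup (Fin 2) ℤ,
    actR (M : Matrix (Fin 2) (Fin 2) ℤ) w = w ↔
      ∃ n : ℤ,
        (M : Matrix (Fin 2) (Fin 2) ℤ) =
          ((g ^ n : Matrix.SpecialLinearGroup (Fin 2) ℤ) : Matrix (Fin 2) (Fin 2) ℤ) ∨
        (M : Matrix (Fin 2) (Fin 2) ℤ) =
          -((g ^ n : Matrix.SpecialLinearGroup (Fin 2) ℤ) : Matrix (Fin 2) (Fin 2) ℤ)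

/-- Contour integral of `g` along the straight line segment from `a` to `b`. -/
def segInt (g : ℂ → ℂ) (a b : ℂ) : ℂ := (b - a) * ∫ t in (0:ℝ)..1, g (a + t * (b - a))

/-- The integrand of the differential `η_{w', w}`. -/
def eta (w w' : ℝ) (z : ℂ) : ℂ := 1 / (z - (w' : ℂ)) - 1 / (z - (w : ℂ))

/-- `∫_{z₀}^{z₁} f η_w`: the contour integral of `f(z)·(1/(z-w') - 1/(z-w)) dz`
along the straight line segment from `z₀` to `z₁`. -/
def cycInt (f : ℂ → ℂ) (w w' : ℝ) (z0 z1 : ℂ) : ℂ := segInt (fun z => f z * eta w w' z) z0 z1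

/-- A holomorphic modular function for `SL(2,ℤ)`: holomorphic on the upper half plane and
invariant under the Möbius action of `SL(2,ℤ)`. -/
def IsModular (f : ℂ → ℂ) : Prop :=
  DifferentiableOn ℂ f {z : ℂ | 0 < z.im} ∧
  ∀ g : Matrix.SpecialLinearGroup (Fin 2) ℤ, ∀ z : ℂ, 0 < z.im →
    f (actC (g : Matrix (Fin 2) (Fin 2) ℤ) z) = f z

/-- `w` is a real quadratic irrational with Galois conjugate `w'` (the other root of the
same integral quadratic equation). -/
def IsQuadPair (w w' : ℝ) : Prop :=
  Irrational w ∧ w' ≠ w ∧ ∃ a b c : ℤ, a ≠ 0 ∧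
    (a : ℝ) * w ^ 2 + (b : ℝ) * w + (c : ℝ) = 0 ∧
    (a : ℝ) * w' ^ 2 + (b : ℝ) * w' + (c : ℝ) = 0

/-- The `i`-th term (0-indexed) of the regular continued fraction expansion of `x`:
term `0` is `⌊x⌋` and term `i+1` is the `i`-th partial denominator. -/
def cfTerm (x : ℝ) (i : ℕ) : Option ℝ :=
  match i with
  | 0 => some (GenContFract.of x).h
  | i + 1 => (GenContFract.of x).partDens.get? i

/-- `w` is a real quadratic irrational. -/
def IsQuadIrr (w : ℝ) : Prop :=
  Irrational w ∧ ∃ a b c : ℤ, a ≠ 0 ∧ (a : ℝ) * w ^ 2 + (b : ℝ) * w + (c : ℝ) = 0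

abbrev SL2Z := Matrix.SpecialLinearGroup (Fin 2) ℤ
abbrev SL2R := Matrix.SpecialLinearGroup (Fin 2) ℝ
/-- The fundamental theorem of calculus for `segInt` on a convex open set. -/
theorem segInt_eq_sub {s : Set ℂ} (hs : Convex ℝ s) {g G : ℂ → ℂ} (hg : ContinuousOn g s)
    (hG : ∀ z ∈ s, HasDerivAt G (g z) z) {a b : ℂ} (ha : a ∈ s) (hb : b ∈ s) :
    segInt g a b = G b - G a := by
  have hmem : ∀ t ∈ Set.uIcc (0 : ℝ) 1, a + (t : ℂ) * (b - a) ∈ s := by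
    intro t ht
    rw [Set.uIcc_of_le zero_le_one] at ht
    simpa using hs.add_smul_sub_mem ha hb ht
  have hderiv : ∀ t ∈ Set.uIcc (0 : ℝ) 1,
      HasDerivAt (fun t : ℝ => G (a + (t : ℂ) * (b - a)))
        (g (a + (t : ℂ) * (b - a)) * (b - a)) t := by
    intro t ht
    have hline : HasDerivAt (fun t : ℝ => a + (t : ℂ) * (b - a)) (b - a) t := by
      simpa using (((hasDerivAt_id t).ofReal_comp).mul_const (b - a)).const_add a
    exact (hG _ (hmem t ht)).comp t hline
  have hcont : ContinuousOn (fun t : ℝ => g (a + (t : ℂ) * (b - a)) * (b - a))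
      (Set.uIcc 0 1) :=
    (hg.comp (by fun_prop) hmem).mul continuousOn_const
  have hftc := intervalIntegral.integral_eq_sub_of_hasDerivAt hderiv hcont.intervalIntegrable
  rw [intervalIntegral.integral_mul_const] at hftc
  rw [segInt, mul_comm, hftc]
  simp

theorem ne_ofReal_of_im_pos {z : ℂ} (hz : 0 < z.im) (x : ℝ) : z - (x : ℂ) ≠ 0 := by
  intro h
  have := congrArg Complex.im h
  simp at this
  exact hz.ne' this

theorem SL2Z_det (γ : SL2Z) : γ 0 0 * γ 1 1 - γ 0 1 * γ 1 0 = 1 := by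
  rw [← Matrix.det_fin_two]
  exact γ.det_coe

theorem denom_ne_zero_of_im_pos (γ : SL2Z) {z : ℂ} (hz : 0 < z.im) :
    (γ 1 0 : ℂ) * z + (γ 1 1 : ℂ) ≠ 0 := by
  intro h
  have him := congrArg Complex.im h
  simp [hz.ne'] at him
  have hd : γ 1 1 = 0 := by simpa [him] using h
  have := SL2Z_det γ
  simp [him, hd] at this

theorem im_actC_pos (γ : SL2Z) {z : ℂ} (hz : 0 < z.im) :
    0 < (actC (γ : Matrix (Fin 2) (Fin 2) ℤ) z).im := by
  have hne := denom_ne_zero_of_im_pos γ hz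
  have hdet : (γ 0 0 : ℝ) * γ 1 1 - γ 0 1 * γ 1 0 = 1 := by exact_mod_cast SL2Z_det γ
  have him : (actC (γ : Matrix (Fin 2) (Fin 2) ℤ) z).im =
      z.im / Complex.normSq ((γ 1 0 : ℂ) * z + (γ 1 1 : ℂ)) := by
    rw [actC, Complex.div_im]
    simp only [Complex.add_im, Complex.mul_im, Complex.add_re, Complex.mul_re,
      Complex.intCast_re, Complex.intCast_im]
    rw [← sub_div]
    congr 1
    linear_combination z.im * hdet
  rw [him]
  exact div_pos hz (Complex.normSq_pos.mpr hne)

theorem hasDerivAt_actC (γ : SL2Z) {z : ℂ} (hz : 0 < z.im) :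
    HasDerivAt (actC (γ : Matrix (Fin 2) (Fin 2) ℤ))
      (1 / ((γ 1 0 : ℂ) * z + (γ 1 1 : ℂ)) ^ 2) z := by
  have hdet : (γ 0 0 : ℂ) * γ 1 1 - γ 0 1 * γ 1 0 = 1 := by exact_mod_cast SL2Z_det γ
  have hlin : ∀ p q : ℂ, HasDerivAt (fun z : ℂ => p * z + q) p z := fun p q => by
    simpa using ((hasDerivAt_id z).const_mul p).add_const q
  convert! (hlin (γ 0 0) (γ 0 1)).fun_div (hlin (γ 1 0) (γ 1 1))
    (denom_ne_zero_of_im_pos γ hz) using 2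
  linear_combination -hdet

/-- The denominators of `γ` at the two members of a quadratic pair do not vanish, as long as
`γ` fixes the second one in the sense of the totalised action `actR`. -/
theorem IsQuadPair.denom_ne_zero {w w' : ℝ} (hq : IsQuadPair w w') (γ : SL2Z)
    (hγw' : actR (γ : Matrix (Fin 2) (Fin 2) ℤ) w' = w') :
    (γ 1 0 : ℝ) * w + γ 1 1 ≠ 0 ∧ (γ 1 0 : ℝ) * w' + γ 1 1 ≠ 0 := by
  obtain ⟨hirr, -, a, b, c, ha, hw, hw'⟩ := hq
  have hlin : ∀ p q : ℤ, p ≠ 0 → (p : ℝ) * w + q ≠ 0 := fun p q hp =>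
    ((hirr.intCast_mul hp).add_intCast q).ne_zero
  refine ⟨fun h => ?_, fun h => ?_⟩
  · by_cases hc : γ 1 0 = 0
    · have hd : γ 1 1 = 0 := by simpa [hc] using h
      have := SL2Z_det γ
      simp [hc, hd] at this
    · exact hlin _ _ hc h
  · have h0 : w' = 0 := by rw [← hγw', actR, h, div_zero]
    have hc : (c : ℝ) = 0 := by simpa [h0] using hw'
    have hmul : w * ((a : ℝ) * w + b) = 0 := by linear_combination hw - hc
    exact (mul_ne_zero hirr.ne_zero (hlin a b ha)) hmul

/-- The displacement of `γ z` from a real fixed point `x` of `γ`. -/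
theorem actC_sub_ofReal_fixed (γ : SL2Z) {x : ℝ}
    (hx : actR (γ : Matrix (Fin 2) (Fin 2) ℤ) x = x) (hne : (γ 1 0 : ℝ) * x + γ 1 1 ≠ 0)
    {z : ℂ} (hz : (γ 1 0 : ℂ) * z + (γ 1 1 : ℂ) ≠ 0) :
    actC (γ : Matrix (Fin 2) (Fin 2) ℤ) z - x =
      (z - x) / (((γ 1 0 : ℂ) * z + γ 1 1) * ((γ 1 0 : ℂ) * x + γ 1 1)) := by
  have hdet : (γ 0 0 : ℂ) * γ 1 1 - γ 0 1 * γ 1 0 = 1 := by exact_mod_cast SL2Z_det γ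
  have hneC : (γ 1 0 : ℂ) * x + γ 1 1 ≠ 0 := by exact_mod_cast hne
  have hfix : (γ 0 0 : ℂ) * x + γ 0 1 = x * ((γ 1 0 : ℂ) * x + γ 1 1) := by
    rw [actR, div_eq_iff hne] at hx
    exact_mod_cast hx
  rw [actC, eq_div_iff (mul_ne_zero hz hneC), div_sub' hz, div_mul_eq_mul_div, div_eq_iff hz]
  linear_combination ((γ 1 0 : ℂ) * z + γ 1 1) *
    ((z - x) * hdet + ((γ 1 0 : ℂ) * z + γ 1 1) * hfix)

/-- If `γ` fixes `w` and `w'`, then `η_w` is invariant under pullback by `γ`. -/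
theorem eta_actC {w w' : ℝ} (hq : IsQuadPair w w') (γ : SL2Z)
    (hγw : actR (γ : Matrix (Fin 2) (Fin 2) ℤ) w = w)
    (hγw' : actR (γ : Matrix (Fin 2) (Fin 2) ℤ) w' = w') {z : ℂ} (hz : 0 < z.im) :
    eta w w' (actC (γ : Matrix (Fin 2) (Fin 2) ℤ) z) *
      (1 / ((γ 1 0 : ℂ) * z + (γ 1 1 : ℂ)) ^ 2) = eta w w' z := by
  obtain ⟨hd, hd'⟩ := hq.denom_ne_zero γ hγw'
  have hj := denom_ne_zero_of_im_pos γ hz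
  have hdC : (γ 1 0 : ℂ) * w + γ 1 1 ≠ 0 := by exact_mod_cast hd
  have hdC' : (γ 1 0 : ℂ) * w' + γ 1 1 ≠ 0 := by exact_mod_cast hd'
  have hz1 := ne_ofReal_of_im_pos hz w
  have hz2 := ne_ofReal_of_im_pos hz w'
  have hww : (w' : ℂ) - w ≠ 0 := sub_ne_zero.mpr (by exact_mod_cast hq.2.1)
  have hfixC : actC (γ : Matrix (Fin 2) (Fin 2) ℤ) (w' : ℂ) = w' := by
    rw [actR] at hγw'
    rw [actC]
    exact_mod_cast hγw'
  have hprod : ((γ 1 0 : ℂ) * w' + γ 1 1) * ((γ 1 0 : ℂ) * w + γ 1 1) = 1 := by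
    have h := actC_sub_ofReal_fixed γ hγw hd hdC'
    rw [hfixC, eq_div_iff (mul_ne_zero hdC' hdC)] at h
    exact mul_left_cancel₀ hww (by rw [h, mul_one])
  rw [eta, eta, actC_sub_ofReal_fixed γ hγw hd hj, actC_sub_ofReal_fixed γ hγw' hd' hj]
  set j := (γ 1 0 : ℂ) * z + γ 1 1
  set p := (γ 1 0 : ℂ) * w + γ 1 1
  set p' := (γ 1 0 : ℂ) * w' + γ 1 1
  have hp : p' * (z - w) - p * (z - w') = j * (w' - w) := by ring
  rw [one_div_div, one_div_div, div_sub_div _ _ hz2 hz1, div_sub_div _ _ hz2 hz1,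
    div_mul_div_comm, div_eq_div_iff (by positivity) (by positivity)]
  linear_combination j * hp

/-- The cycle integral `∫_{z₀}^{γ z₀} f η_w` is independent of the basepoint `z₀ ∈ ℍ`. -/
theorem cycInt_basepoint_independent
    (f : ℂ → ℂ) (hf : IsModular f)
    (w w' : ℝ) (hq : IsQuadPair w w')
    (γ : SL2Z)
    (hγw : actR (γ : Matrix (Fin 2) (Fin 2) ℤ) w = w)
    (hγw' : actR (γ : Matrix (Fin 2) (Fin 2) ℤ) w' = w') :
    ∀ z0 z1 : ℂ, 0 < z0.im → 0 < z1.im →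
      cycInt f w w' z0 (actC (γ : Matrix (Fin 2) (Fin 2) ℤ) z0) =
        cycInt f w w' z1 (actC (γ : Matrix (Fin 2) (Fin 2) ℤ) z1) := by
  have hconv : Convex ℝ {z : ℂ | 0 < z.im} := convex_halfSpace_im_gt 0
  have hopen : IsOpen {z : ℂ | 0 < z.im} := isOpen_lt continuous_const Complex.continuous_im
  have hdiff : DifferentiableOn ℂ (fun z => f z * eta w w' z) {z : ℂ | 0 < z.im} := by
    refine hf.1.mul fun z hz => DifferentiableAt.differentiableWithinAt ?_
    have hz1 := ne_ofReal_of_im_pos hz w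
    have hz2 := ne_ofReal_of_im_pos hz w'
    unfold eta
    fun_prop (disch := assumption)
  obtain ⟨G, hG'⟩ := hconv.exists_forall_hasDerivWithinAt hdiff
  have hG : ∀ z ∈ {z : ℂ | 0 < z.im}, HasDerivAt G (f z * eta w w' z) z :=
    fun z hz => (hG' z hz).hasDerivAt (hopen.mem_nhds hz)
  have hΦ : ∀ z ∈ {z : ℂ | 0 < z.im},
      HasDerivAt (fun z => G (actC (γ : Matrix (Fin 2) (Fin 2) ℤ) z) - G z) 0 z := by
    intro z hz
    have h := ((hG _ (im_actC_pos γ hz)).comp z (hasDerivAt_actC γ hz)).sub (hG z hz)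
    rwa [hf.2 γ z hz, mul_assoc, eta_actC hq γ hγw hγw' hz, sub_self] at h
  obtain ⟨k, hk⟩ := hopen.exists_is_const_of_deriv_eq_zero hconv.isPreconnected
    (fun z hz => (hΦ z hz).differentiableAt.differentiableWithinAt) (fun z hz => (hΦ z hz).deriv)
  have hint : ∀ z : ℂ, 0 < z.im →
      cycInt f w w' z (actC (γ : Matrix (Fin 2) (Fin 2) ℤ) z) = k := fun z hz => by
    rw [cycInt, segInt_eq_sub hconv hdiff.continuousOn hG hz (im_actC_pos γ hz)]
    exact hk z hz
  intro z0 z1 hz0 hz1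
  rw [hint z0 hz0, hint z1 hz1]
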